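/- There is no nonzero bounded bilinear form on c₀ × c₀ with the Bhatia–Šemrl property; that is, BS(c₀,c₀;𝕂) = {0} for 𝕂 = ℝ or ℂ. -/

import Mathlib

noncomputable section

/-- `x` is Birkhoff--James orthogonal to `y`: `‖x‖ ≤ ‖x + a • y‖` for every scalar `a`. -/
def BJOrth (𝕂 : Type*) [RCLike 𝕂] {E : Type*} [NormedAddCommGroup E] [NormedSpace 𝕂 E]
    (x y : E) : Prop :=
  ∀ a : 𝕂, ‖x‖ ≤ ‖x + a • y‖

/-- The Bhatia--Šemrl property for bounded bilinear maps (encoded in curried form,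
whose operator norm is the supremum norm over `S_X × S_Y`). -/
def HasBSPropBilin (𝕂 : Type*) [RCLike 𝕂] {X Y Z : Type*}
    [NormedAddCommGroup X] [NormedSpace 𝕂 X] [NormedAddCommGroup Y] [NormedSpace 𝕂 Y]
    [NormedAddCommGroup Z] [NormedSpace 𝕂 Z] (A : X →L[𝕂] Y →L[𝕂] Z) : Prop :=
  ∀ B : X →L[𝕂] Y →L[𝕂] Z, BJOrth 𝕂 A B →
    ∃ (x : X) (y : Y), ‖x‖ = 1 ∧ ‖y‖ = 1 ∧ ‖A x y‖ = ‖A‖ ∧ BJOrth 𝕂 (A x y) (B x y)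

section

open scoped ZeroAtInfty

namespace ZeroAtInftyContinuousMap

variable {𝕂 : Type*} [RCLike 𝕂]

theorem norm_apply_le_norm (x : C₀(ℕ, 𝕂)) (k : ℕ) : ‖x k‖ ≤ ‖x‖ := by
  rw [← norm_toBCF_eq_norm]
  exact x.toBCF.norm_coe_le_norm k

theorem norm_le_of_forall_norm_apply_le {x : C₀(ℕ, 𝕂)} {C : ℝ} (hC : 0 ≤ C)
    (h : ∀ k, ‖x k‖ ≤ C) : ‖x‖ ≤ C := by
  rw [← norm_toBCF_eq_norm]
  exact (BoundedContinuousFunction.norm_le hC).2 h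

theorem tendsto_atTop_zero (x : C₀(ℕ, 𝕂)) :
    Filter.Tendsto x Filter.atTop (nhds 0) := by
  have h := x.zero_at_infty'
  rwa [Filter.cocompact_eq_cofinite, Nat.cofinite_eq_atTop] at h

/-- A sequence that vanishes from some index on, as an element of `c₀`. -/
def ofEventuallyZero (f : ℕ → 𝕂) (n : ℕ) (hf : ∀ k, n ≤ k → f k = 0) : C₀(ℕ, 𝕂) where
  toFun := f
  continuous_toFun := continuous_of_discreteTopology
  zero_at_infty' := by
    rw [Filter.cocompact_eq_cofinite, Nat.cofinite_eq_atTop]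
    exact tendsto_const_nhds.congr' <|
      (Filter.eventually_ge_atTop n).mono fun k hk ↦ (hf k hk).symm

@[simp]
theorem ofEventuallyZero_apply (f : ℕ → 𝕂) (n : ℕ) (hf : ∀ k, n ≤ k → f k = 0) (k : ℕ) :
    ofEventuallyZero f n hf k = f k := rfl

theorem norm_geometric_mul_le (N : ℕ) (x : C₀(ℕ, 𝕂)) (m : ℕ) :
    ‖(1 / 2 / 2 ^ m : 𝕂) * x (N + m)‖ ≤ 1 / 2 / 2 ^ m * ‖x‖ := by
  rw [norm_mul]
  have : ‖(1 / 2 / 2 ^ m : 𝕂)‖ = 1 / 2 / 2 ^ m := by simp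
  rw [this]
  gcongr
  exact norm_apply_le_norm x _

theorem summable_norm_geometric_mul (N : ℕ) (x : C₀(ℕ, 𝕂)) :
    Summable fun m ↦ ‖(1 / 2 / 2 ^ m : 𝕂) * x (N + m)‖ :=
  Summable.of_nonneg_of_le (fun _ ↦ norm_nonneg _) (norm_geometric_mul_le N x)
    ((summable_geometric_two' 1).mul_right _)

/-- The functional `x ↦ ∑ₘ 2⁻¹⁻ᵐ x (N + m)` on `c₀`. -/
def geometricTail (𝕂 : Type*) [RCLike 𝕂] (N : ℕ) : C₀(ℕ, 𝕂) →L[𝕂] 𝕂 :=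
  LinearMap.mkContinuous
    { toFun := fun x ↦ ∑' m : ℕ, (1 / 2 / 2 ^ m : 𝕂) * x (N + m)
      map_add' := fun x y ↦ by
        rw [← (summable_norm_geometric_mul N x).of_norm.tsum_add
          (summable_norm_geometric_mul N y).of_norm]
        simp [mul_add]
      map_smul' := fun c x ↦ by
        simp only [smul_apply, smul_eq_mul, RingHom.id_apply, ← tsum_mul_left]
        exact tsum_congr fun m ↦ by ring }
    1 fun x ↦ by
      refine tsum_of_norm_bounded ?_ (norm_geometric_mul_le N x)
      exact (hasSum_geometric_two' 1).mul_right ‖x‖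

theorem geometricTail_apply (N : ℕ) (x : C₀(ℕ, 𝕂)) :
    geometricTail 𝕂 N x = ∑' m : ℕ, (1 / 2 / 2 ^ m : 𝕂) * x (N + m) := rfl

theorem norm_geometricTail_apply_lt_one (N : ℕ) {x : C₀(ℕ, 𝕂)} (hx : ‖x‖ ≤ 1) :
    ‖geometricTail 𝕂 N x‖ < 1 := by
  have hlim := (tendsto_atTop_zero x).norm
  rw [norm_zero] at hlim
  obtain ⟨k, hk⟩ := Filter.eventually_atTop.1 (hlim.eventually_lt_const one_pos)
  rw [geometricTail_apply]
  refine (norm_tsum_le_tsum_norm (summable_norm_geometric_mul N x)).trans_lt ?_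
  rw [← tsum_geometric_two' 1]
  refine Summable.tsum_lt_tsum (i := k) (fun m ↦ ?_) ?_
    (summable_norm_geometric_mul N x) (summable_geometric_two' 1)
  · refine (norm_geometric_mul_le N x m).trans ?_
    exact mul_le_of_le_one_right (by positivity) hx
  · have : ‖(1 / 2 / 2 ^ k : 𝕂)‖ = 1 / 2 / 2 ^ k := by simp
    rw [norm_mul, this]
    exact mul_lt_of_lt_one_right (by positivity) (hk _ (by omega))

theorem geometricTail_apply_of_eq_one (N n : ℕ) {x : C₀(ℕ, 𝕂)}
    (h₁ : ∀ m < n, x (N + m) = 1) (h₀ : ∀ m, n ≤ m → x (N + m) = 0) :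
    geometricTail 𝕂 N x = 1 - (1 / 2) ^ n := by
  rw [geometricTail_apply, tsum_eq_sum (s := Finset.range n)
    fun m hm ↦ by rw [h₀ m (by simpa using hm), mul_zero],
    Finset.sum_congr rfl fun m hm ↦ by rw [h₁ m (Finset.mem_range.1 hm), mul_one]]
  clear h₁ h₀
  induction n with
  | zero => simp
  | succ n ih =>
    rw [Finset.sum_range_succ, ih, pow_succ, one_div_pow]
    field_simp
    ring

end ZeroAtInftyContinuousMap

open ZeroAtInftyContinuousMap

theorem eq_zero_of_norm_add_le_of_norm_sub_le {𝕂 : Type*} [RCLike 𝕂] {a b : 𝕂}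
    (h₁ : ‖a + b‖ ≤ ‖a‖) (h₂ : ‖a - b‖ ≤ ‖a‖) : b = 0 := by
  have h := parallelogram_law_with_norm 𝕂 a b
  have : ‖b‖ * ‖b‖ ≤ 0 := by
    nlinarith [mul_self_le_mul_self (norm_nonneg _) h₁, mul_self_le_mul_self (norm_nonneg _) h₂]
  exact norm_eq_zero.1 (mul_self_eq_zero.1 (this.antisymm (mul_self_nonneg _)))

/-- A functional on `c₀` attaining its norm vanishes on all sequences supported far enough out. -/
theorem exists_forall_eq_zero_of_attains_norm {𝕂 : Type*} [RCLike 𝕂] (f : C₀(ℕ, 𝕂) →L[𝕂] 𝕂)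
    {x : C₀(ℕ, 𝕂)} (hx : ‖x‖ ≤ 1) (hf : ∀ z, ‖z‖ ≤ 1 → ‖f z‖ ≤ ‖f x‖) :
    ∃ N, ∀ u : C₀(ℕ, 𝕂), (∀ k < N, u k = 0) → f u = 0 := by
  have hlim := (tendsto_atTop_zero x).norm
  rw [norm_zero] at hlim
  obtain ⟨N, hN⟩ := Filter.eventually_atTop.1 (hlim.eventually_lt_const (one_half_pos (α := ℝ)))
  have small (u : C₀(ℕ, 𝕂)) (hu : ∀ k < N, u k = 0) (hu' : ‖u‖ ≤ 1 / 2) : ‖x + u‖ ≤ 1 := by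
    refine norm_le_of_forall_norm_apply_le zero_le_one fun k ↦ ?_
    rw [ZeroAtInftyContinuousMap.add_apply]
    rcases lt_or_ge k N with hk | hk
    · rw [hu k hk, add_zero]
      exact (norm_apply_le_norm x k).trans hx
    · linarith [norm_add_le (x k) (u k), hN k hk, norm_apply_le_norm u k]
  refine ⟨N, fun u hu ↦ ?_⟩
  set c : ℝ := 1 / (2 * (‖u‖ + 1)) with hc
  have hcpos : 0 < c := by positivity
  have hnorm : ‖(c : 𝕂) • u‖ ≤ 1 / 2 := by
    rw [norm_smul, RCLike.norm_ofReal, abs_of_pos hcpos, hc, div_mul_eq_mul_div,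
      div_le_div_iff₀ (by positivity) two_pos]
    linarith
  have hsupp : ∀ k < N, ((c : 𝕂) • u) k = 0 := fun k hk ↦ by simp [hu k hk]
  have hzero : f ((c : 𝕂) • u) = 0 := by
    refine eq_zero_of_norm_add_le_of_norm_sub_le (a := f x) ?_ ?_
    · rw [← map_add]
      exact hf _ (small _ hsupp hnorm)
    · rw [← map_sub, sub_eq_add_neg]
      refine hf _ (small _ (fun k hk ↦ ?_) (by rwa [norm_neg]))
      rw [ZeroAtInftyContinuousMap.neg_apply, hsupp k hk, neg_zero]
  rw [map_smul, smul_eq_zero] at hzero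
  exact hzero.resolve_left (by exact_mod_cast hcpos.ne')

theorem BJOrth.eq_zero_or_eq_zero {𝕂 : Type*} [RCLike 𝕂] {a b : 𝕂} (h : BJOrth 𝕂 a b) :
    a = 0 ∨ b = 0 := by
  by_contra! hab
  have := h (-a / b)
  rw [smul_eq_mul, div_mul_cancel₀ _ hab.2, add_neg_cancel, norm_zero] at this
  exact hab.1 (norm_le_zero_iff.1 this)

theorem ContinuousLinearMap.norm_apply_apply_le_of_norm_le_one {𝕂 X Y : Type*} [RCLike 𝕂]
    [NormedAddCommGroup X] [NormedSpace 𝕂 X] [NormedAddCommGroup Y] [NormedSpace 𝕂 Y]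
    (T : X →L[𝕂] Y →L[𝕂] 𝕂) {x : X} {y : Y} (hx : ‖x‖ ≤ 1) (hy : ‖y‖ ≤ 1) :
    ‖T x y‖ ≤ ‖T‖ := by
  simpa using T.le_of_opNorm₂_le_of_le le_rfl hx hy

theorem HasBSPropBilin.exists_attains_norm {𝕂 X Y : Type*} [RCLike 𝕂]
    [NormedAddCommGroup X] [NormedSpace 𝕂 X] [NormedAddCommGroup Y] [NormedSpace 𝕂 Y]
    {A : X →L[𝕂] Y →L[𝕂] 𝕂} (hBS : HasBSPropBilin 𝕂 A) :
    ∃ (x : X) (y : Y), ‖x‖ = 1 ∧ ‖y‖ = 1 ∧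
      ∀ (z : X) (w : Y), ‖z‖ ≤ 1 → ‖w‖ ≤ 1 → ‖A z w‖ ≤ ‖A x y‖ := by
  obtain ⟨x, y, hx, hy, hxy, -⟩ := hBS 0 fun a ↦ by simp
  exact ⟨x, y, hx, hy, fun z w hz hw ↦
    hxy ▸ A.norm_apply_apply_le_of_norm_le_one hz hw⟩

theorem hasBSPropBilin_zero {𝕂 X Y : Type*} [RCLike 𝕂]
    [NormedAddCommGroup X] [NormedSpace 𝕂 X] [NormedAddCommGroup Y] [NormedSpace 𝕂 Y]
    (hX : ∃ x : X, ‖x‖ = 1) (hY : ∃ y : Y, ‖y‖ = 1) :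
    HasBSPropBilin 𝕂 (0 : X →L[𝕂] Y →L[𝕂] 𝕂) := by
  obtain ⟨x, hx⟩ := hX
  obtain ⟨y, hy⟩ := hY
  exact fun B _ ↦ ⟨x, y, hx, hy, by simp [ContinuousLinearMap.opNorm_zero], fun a ↦ by
    rw [_root_.zero_apply, _root_.zero_apply, norm_zero]
    exact norm_nonneg _⟩

/-- If `A` attains its norm at `(x₀, y₀)` and a functional `g` of norm one which does not attain
its norm is normed by a sequence along which `A · y₀` is constantly `A x₀ y₀`, then the form
`A - g ⊗ A x₀` witnesses the failure of the Bhatia–Šemrl property. -/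
theorem not_hasBSPropBilin_of_tendsto_one {𝕂 X Y : Type*} [RCLike 𝕂]
    [NormedAddCommGroup X] [NormedSpace 𝕂 X] [NormedAddCommGroup Y] [NormedSpace 𝕂 Y]
    {A : X →L[𝕂] Y →L[𝕂] 𝕂} (hA : A ≠ 0) {x₀ : X} {y₀ : Y} (hx₀ : ‖x₀‖ ≤ 1) (hy₀ : ‖y₀‖ ≤ 1)
    (hatt : ∀ (z : X) (w : Y), ‖z‖ ≤ 1 → ‖w‖ ≤ 1 → ‖A z w‖ ≤ ‖A x₀ y₀‖)
    (g : X →L[𝕂] 𝕂) (hg : ∀ x, ‖x‖ ≤ 1 → ‖g x‖ < 1) (z : ℕ → X) (hz : ∀ n, ‖z n‖ ≤ 1)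
    (hAz : ∀ n, A (z n) y₀ = A x₀ y₀)
    (hgz : Filter.Tendsto (fun n ↦ g (z n)) Filter.atTop (nhds 1)) :
    ¬ HasBSPropBilin 𝕂 A := by
  intro hBS
  have hApos : 0 < ‖A‖ := by
    refine A.opNorm_nonneg.lt_of_ne fun h ↦ hA ?_
    ext x y
    simpa [← h] using A.le_opNorm₂ x y
  have hnorm : ‖A x₀ y₀‖ = ‖A‖ := by
    obtain ⟨x, y, hx, hy, hxy, -⟩ := hBS 0 fun a ↦ by simp
    exact (A.norm_apply_apply_le_of_norm_le_one hx₀ hy₀).antisymm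
      (hxy ▸ hatt x y hx.le hy.le)
  obtain ⟨x, y, hx, hy, hxy, horth⟩ := hBS (A - g.smulRight (A x₀)) fun a ↦ by
    have key (n : ℕ) :
        ‖A‖ * ‖1 + a * (1 - g (z n))‖ ≤ ‖A + a • (A - g.smulRight (A x₀))‖ := by
      refine le_trans (le_of_eq ?_)
        (ContinuousLinearMap.norm_apply_apply_le_of_norm_le_one _ (hz n) hy₀)
      simp only [_root_.add_apply, _root_.smul_apply,
        _root_.sub_apply, ContinuousLinearMap.smulRight_apply, hAz, smul_eq_mul]
      rw [← hnorm, ← norm_mul]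
      congr 1
      ring
    have hlim : Filter.Tendsto (fun n ↦ ‖A‖ * ‖1 + a * (1 - g (z n))‖) Filter.atTop
        (nhds ‖A‖) := by
      simpa using (((hgz.const_sub 1).const_mul a).const_add 1).norm.const_mul ‖A‖
    exact le_of_tendsto' hlim key
  rcases horth.eq_zero_or_eq_zero with h | h
  · rw [h, norm_zero] at hxy
    exact hApos.ne hxy
  · simp only [_root_.sub_apply, ContinuousLinearMap.smulRight_apply,
      _root_.smul_apply, smul_eq_mul, sub_eq_zero] at h
    have hlt : ‖g x‖ * ‖A x₀ y‖ < ‖A‖ :=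
      (mul_le_mul_of_nonneg_left (A.norm_apply_apply_le_of_norm_le_one hx₀ hy.le)
        (norm_nonneg _)).trans_lt (mul_lt_of_lt_one_left hApos (hg x hx.le))
    rw [← norm_mul, ← h, hxy] at hlt
    exact hlt.false

theorem not_hasBSPropBilin_of_ne_zero {𝕂 : Type*} [RCLike 𝕂]
    {A : C₀(ℕ, 𝕂) →L[𝕂] C₀(ℕ, 𝕂) →L[𝕂] 𝕂} (hA : A ≠ 0) : ¬ HasBSPropBilin 𝕂 A := by
  intro hBS
  obtain ⟨x₀, y₀, hx₀, hy₀, hatt⟩ := hBS.exists_attains_norm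
  obtain ⟨N, hN⟩ := exists_forall_eq_zero_of_attains_norm
    ((ContinuousLinearMap.apply 𝕂 𝕂 y₀).comp A) hx₀.le fun z hz ↦ hatt z y₀ hz hy₀.le
  let z (n : ℕ) : C₀(ℕ, 𝕂) := ofEventuallyZero
    (fun k ↦ if k < N then x₀ k else if k < N + n then 1 else 0) (N + n)
    fun k hk ↦ by simp [hk.not_gt, show ¬ k < N by omega]
  refine not_hasBSPropBilin_of_tendsto_one hA hx₀.le hy₀.le hatt (geometricTail 𝕂 N)
    (fun x hx ↦ norm_geometricTail_apply_lt_one N hx) z (fun n ↦ ?_) (fun n ↦ ?_) ?_ hBS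
  · refine norm_le_of_forall_norm_apply_le zero_le_one fun k ↦ ?_
    simp only [z, ofEventuallyZero_apply]
    split_ifs
    · exact (norm_apply_le_norm x₀ k).trans hx₀.le
    · simp
    · simp
  · have h := hN (z n - x₀) fun k hk ↦ by simp [z, hk]
    rw [map_sub, sub_eq_zero] at h
    exact h
  · have hgz (n : ℕ) : geometricTail 𝕂 N (z n) = 1 - (1 / 2) ^ n :=
      geometricTail_apply_of_eq_one N n (fun m hm ↦ by simp [z, hm])
        fun m hm ↦ by simp [z, hm.not_gt]
    have hpow : Filter.Tendsto (fun n : ℕ ↦ (1 / 2 : 𝕂) ^ n) Filter.atTop (nhds 0) :=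
      tendsto_pow_atTop_nhds_zero_of_norm_lt_one (by simpa using by norm_num)
    simp only [hgz]
    simpa using hpow.const_sub 1

theorem exists_norm_eq_one_zeroAtInfty (𝕂 : Type*) [RCLike 𝕂] : ∃ x : C₀(ℕ, 𝕂), ‖x‖ = 1 := by
  refine ⟨ofEventuallyZero (fun k ↦ if k = 0 then 1 else 0) 1
    fun k hk ↦ by simp [show k ≠ 0 by omega], le_antisymm ?_ ?_⟩
  · refine norm_le_of_forall_norm_apply_le zero_le_one fun k ↦ ?_
    rw [ofEventuallyZero_apply]
    split_ifs <;> simp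
  · refine le_trans ?_ (norm_apply_le_norm _ 0)
    simp

end

open scoped ZeroAtInfty in
/-- The zero form is the only bounded bilinear form on `c₀ × c₀` with the
Bhatia--Šemrl property. -/
theorem BS_bilinear_c0_c0_eq_zero {𝕂 : Type*} [RCLike 𝕂] :
    {A : C₀(ℕ, 𝕂) →L[𝕂] C₀(ℕ, 𝕂) →L[𝕂] 𝕂 | HasBSPropBilin 𝕂 A} = {0} := by
  ext A
  rw [Set.mem_ofPred_eq, Set.mem_singleton_iff]
  refine ⟨fun h ↦ by_contra fun hA ↦ not_hasBSPropBilin_of_ne_zero hA h, ?_⟩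
  rintro rfl
  exact hasBSPropBilin_zero (exists_norm_eq_one_zeroAtInfty 𝕂) (exists_norm_eq_one_zeroAtInfty 𝕂)
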